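/- Let R and S be commutative rings, and let F : Mod_R → Mod_S be a colimit-preserving symmetric monoidal functor. Then there is a ring homomorphism φ : R → S such that F is naturally monoidally isomorphic to the base change functor S ⊗_R − (with S an R-algebra via φ). -/

import Mathlib

open CategoryTheory MonoidalCategory
open scoped ChangeOfRings TensorProduct

universe u

/-- An isomorphism `e : F ≅ extendScalars φ` is *monoidal* (compatible with the symmetric
monoidal structures) if it transports the unit and multiplication structure maps of `F`
to the canonical ones of the base-change functor `S ⊗[R] −`, i.e. `ε ↦ 1 ⊗ 1` and
`μ((s ⊗ m) ⊗ (t ⊗ n)) = (s * t) ⊗ (m ⊗ n)`. -/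
def IsMonoidalBaseChangeIso {R S : Type u} [CommRing R] [CommRing S] (φ : R →+* S)
    (F : ModuleCat.{u} R ⥤ ModuleCat.{u} S) [F.LaxMonoidal]
    (e : F ≅ ModuleCat.extendScalars φ) : Prop :=
  (e.hom.app (𝟙_ (ModuleCat.{u} R)) (Functor.LaxMonoidal.ε F (1 : S)) =
    ((1 : S) ⊗ₜ[R,φ] (1 : R) : (ModuleCat.extendScalars φ).obj (𝟙_ (ModuleCat.{u} R)))) ∧
  ∀ (M N : ModuleCat.{u} R) (s t : S) (m : M) (n : N),
    e.hom.app (M ⊗ N) (Functor.LaxMonoidal.μ F M N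
        ((e.inv.app M ((s ⊗ₜ[R,φ] m : (ModuleCat.extendScalars φ).obj M))) ⊗ₜ[S]
         (e.inv.app N ((t ⊗ₜ[R,φ] n : (ModuleCat.extendScalars φ).obj N))))) =
      ((s * t) ⊗ₜ[R,φ] (m ⊗ₜ[R] n) : (ModuleCat.extendScalars φ).obj (M ⊗ N))

open CategoryTheory.Limits CategoryTheory.Functor

noncomputable section

namespace ModuleCat

section Span

variable {R : Type u} [CommRing R]

/-- The morphism from the unit object classifying an element of a module. -/
def spanHom (M : ModuleCat.{u} R) (m : M) : 𝟙_ (ModuleCat.{u} R) ⟶ M :=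
  ofHom (X := R) (LinearMap.toSpanSingleton R M m)

lemma spanHom_apply (M : ModuleCat.{u} R) (m : M) (r : R) : spanHom M m r = r • m := rfl

lemma spanHom_add (M : ModuleCat.{u} R) (m n : M) :
    spanHom M (m + n) = spanHom M m + spanHom M n := by
  ext
  exact smul_add _ _ _

lemma spanHom_comp {M N : ModuleCat.{u} R} (m : M) (f : M ⟶ N) :
    spanHom M m ≫ f = spanHom N (f m) := by
  ext
  exact _root_.map_smul f.hom _ _

lemma spanHom_smul (M : ModuleCat.{u} R) (r : R) (m : M) :
    spanHom M (r • m) = spanHom (𝟙_ (ModuleCat.{u} R)) r ≫ spanHom M m := by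
  rw [spanHom_comp, spanHom_apply]

lemma spanHom_unit_one : spanHom (𝟙_ (ModuleCat.{u} R)) (1 : R) = 𝟙 _ := by
  ext
  exact mul_one (1 : R)

lemma spanHom_tmul (M N : ModuleCat.{u} R) (m : M) (n : N) :
    spanHom (M ⊗ N) (m ⊗ₜ[R] n) =
      (λ_ (𝟙_ (ModuleCat.{u} R))).inv ≫ (spanHom M m ⊗ₘ spanHom N n) := by
  ext
  change (1 : R) • (m ⊗ₜ[R] n) = ((1 : R) • m) ⊗ₜ[R] ((1 : R) • n)
  simp only [one_smul]

/-- A natural transformation between functors out of a module category which preserve colimits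
is an isomorphism as soon as its component at the free module of rank one is. -/
theorem isIso_of_isIso_app_unit {D : Type*} [Category* D] {G H : ModuleCat.{u} R ⥤ D}
    [PreservesColimitsOfSize.{u, u} G] [PreservesColimitsOfSize.{u, u} H]
    (α : G ⟶ H) [IsIso (α.app (𝟙_ (ModuleCat.{u} R)))] : IsIso α := by
  have := preservesColimitsOfSize_shrink.{0, u, 0, u} G
  have := preservesColimitsOfSize_shrink.{0, u, 0, u} H
  have h_free (I : Type u) : IsIso (α.app (∐ fun _ : I ↦ 𝟙_ (ModuleCat.{u} R))) := by
    have (j : Discrete I) : IsIso ((whiskerLeft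
        (Discrete.functor fun _ : I ↦ 𝟙_ (ModuleCat.{u} R)) α).app j) := by
      dsimp
      infer_instance
    have := NatIso.isIso_of_isIso_app (whiskerLeft
        (Discrete.functor fun _ : I ↦ 𝟙_ (ModuleCat.{u} R)) α)
    exact isIso_app_coconePt_of_preservesColimit _ α _ (colimit.isColimit _)
  let p (M : ModuleCat.{u} R) : (∐ fun _ : M ↦ 𝟙_ (ModuleCat.{u} R)) ⟶ M :=
    Sigma.desc (spanHom M)
  have hp (M : ModuleCat.{u} R) : Epi (p M) := by
    rw [epi_iff_surjective]
    intro m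
    refine ⟨Sigma.ι (fun _ : M ↦ 𝟙_ (ModuleCat.{u} R)) m (1 : R), ?_⟩
    rw [← comp_apply, Sigma.ι_desc, spanHom_apply, one_smul]
  have (M : ModuleCat.{u} R) : IsIso (α.app M) := by
    have := hp M
    have := hp (kernel (p M))
    let f := p (kernel (p M)) ≫ kernel.ι (p M)
    have hc : IsColimit (CokernelCofork.ofπ (f := f) (p M) (by simp [f])) :=
      isCokernelEpiComp (Abelian.epiIsCokernelOfKernel _ (kernelIsKernel (p M)))
        (p (kernel (p M))) rfl
    have (j : WalkingParallelPair) : IsIso ((whiskerLeft (parallelPair f 0) α).app j) := by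
      cases j
      · exact h_free _
      · exact h_free _
    have := NatIso.isIso_of_isIso_app (whiskerLeft (parallelPair f 0) α)
    exact isIso_app_coconePt_of_preservesColimit _ α _ hc
  exact NatIso.isIso_of_isIso_app α

end Span

section Monoidal

variable {R S : Type u} [CommRing R] [CommRing S]
  (F : ModuleCat.{u} R ⥤ ModuleCat.{u} S) [F.Monoidal]

/-- The image of an element of `M` in `F.obj M`. -/
def unitMap (M : ModuleCat.{u} R) (m : M) : F.obj M :=
  F.map (spanHom M m) (LaxMonoidal.ε F (1 : S))

lemma map_unitMap {M N : ModuleCat.{u} R} (f : M ⟶ N) (m : M) :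
    F.map f (unitMap F M m) = unitMap F N (f m) := by
  rw [unitMap, unitMap, ← comp_apply, ← F.map_comp, spanHom_comp]

lemma unitMap_unit_one :
    unitMap F (𝟙_ (ModuleCat.{u} R)) (1 : R) = LaxMonoidal.ε F (1 : S) := by
  rw [unitMap, spanHom_unit_one, F.map_id, id_apply]

lemma unitMap_tmul (M N : ModuleCat.{u} R) (m : M) (n : N) :
    unitMap F (M ⊗ N) (m ⊗ₜ[R] n) =
      LaxMonoidal.μ F M N (unitMap F M m ⊗ₜ[S] unitMap F N n) := by
  have h : LaxMonoidal.ε F ≫ F.map (spanHom (M ⊗ N) (m ⊗ₜ[R] n)) =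
      (λ_ (𝟙_ (ModuleCat.{u} S))).inv ≫
        ((LaxMonoidal.ε F ≫ F.map (spanHom M m)) ⊗ₘ (LaxMonoidal.ε F ≫ F.map (spanHom N n))) ≫
        LaxMonoidal.μ F M N := by
    rw [spanHom_tmul, F.map_comp, ← MonoidalCategory.tensorHom_comp_tensorHom, Category.assoc,
      LaxMonoidal.μ_natural, MonoidalCategory.tensorHom_def' (LaxMonoidal.ε F), Category.assoc,
      ← MonoidalCategory.leftUnitor_inv_naturality_assoc, LaxMonoidal.left_unitality_inv_assoc]
  exact congr($h (1 : S))

/-- The scalar in `S` by which `F` acts on the endomorphism `r` of the unit object. -/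
def unitScalar (r : R) : S :=
  OplaxMonoidal.η F (unitMap F (𝟙_ (ModuleCat.{u} R)) r)

lemma η_smul_ε (x : F.obj (𝟙_ (ModuleCat.{u} R))) :
    (OplaxMonoidal.η F x : S) • LaxMonoidal.ε F (1 : S) = x := by
  have h := congr($(Monoidal.η_ε F) x)
  rw [comp_apply, id_apply] at h
  conv_rhs => rw [← h]
  rw [← _root_.map_smul]
  congr 1
  exact mul_one (OplaxMonoidal.η F x : S)

lemma η_ε_one : (OplaxMonoidal.η F (LaxMonoidal.ε F (1 : S)) : S) = 1 :=
  congr($(Monoidal.ε_η F) (1 : S))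

lemma unitMap_smul (M : ModuleCat.{u} R) (r : R) (m : M) :
    unitMap F M (r • m) = unitScalar F r • unitMap F M m := by
  rw [unitMap, spanHom_smul, F.map_comp, comp_apply]
  change F.map (spanHom M m) (unitMap F (𝟙_ (ModuleCat.{u} R)) r) = _
  rw [← η_smul_ε F (unitMap F (𝟙_ (ModuleCat.{u} R)) r), _root_.map_smul]
  rfl

variable [F.Additive]

lemma unitMap_add (M : ModuleCat.{u} R) (m n : M) :
    unitMap F M (m + n) = unitMap F M m + unitMap F M n := by
  rw [unitMap, spanHom_add, F.map_add]
  rfl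

/-- The ring homomorphism induced by an additive monoidal functor on endomorphisms of the unit. -/
def unitRingHom : R →+* S where
  toFun := unitScalar F
  map_one' := by
    rw [unitScalar, unitMap_unit_one, η_ε_one]
  map_mul' r s := by
    have h := unitMap_smul F (𝟙_ (ModuleCat.{u} R)) r s
    exact (congrArg (OplaxMonoidal.η F) h).trans (_root_.map_smul (OplaxMonoidal.η F).hom _ _)
  map_zero' := by
    have h : unitMap F (𝟙_ (ModuleCat.{u} R)) (0 : R) = 0 := by
      simpa using unitMap_add F (𝟙_ (ModuleCat.{u} R)) (0 : R) (0 : R)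
    exact (congrArg (OplaxMonoidal.η F) h).trans (map_zero (OplaxMonoidal.η F).hom)
  map_add' r s := by
    have h := unitMap_add F (𝟙_ (ModuleCat.{u} R)) r s
    exact (congrArg (OplaxMonoidal.η F) h).trans (map_add (OplaxMonoidal.η F).hom _ _)

/-- The comparison map from base change, sending `s ⊗ m` to `s • unitMap F M m`. -/
def baseChangeComparisonApp (M : ModuleCat.{u} R) :
    (extendScalars (unitRingHom F)).obj M ⟶ F.obj M :=
  ExtendRestrictScalarsAdj.HomEquiv.fromExtendScalars (unitRingHom F)
    (ofHom (Y := (restrictScalars (unitRingHom F)).obj (F.obj M))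
      { toFun := unitMap F M
        map_add' := unitMap_add F M
        map_smul' := unitMap_smul F M })

/-- The comparison from base change to an additive monoidal functor. -/
def baseChangeComparison : extendScalars (unitRingHom F) ⟶ F where
  app := baseChangeComparisonApp F
  naturality M N f := by
    ext m
    change (1 : S) • unitMap F N (f m) = F.map f ((1 : S) • unitMap F M m)
    rw [one_smul, one_smul, map_unitMap]

lemma baseChangeComparison_app_tmul (M : ModuleCat.{u} R) (s : S) (m : M) :
    (baseChangeComparison F).app M
      (s ⊗ₜ[R,unitRingHom F] m : (extendScalars (unitRingHom F)).obj M) = s • unitMap F M m :=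
  rfl

lemma baseChangeComparison_app_unit_one :
    (baseChangeComparison F).app (𝟙_ (ModuleCat.{u} R))
      ((1 : S) ⊗ₜ[R,unitRingHom F] (1 : R) :
        (extendScalars (unitRingHom F)).obj (𝟙_ (ModuleCat.{u} R))) =
      LaxMonoidal.ε F (1 : S) := by
  rw [baseChangeComparison_app_tmul, one_smul, unitMap_unit_one]

instance isIso_baseChangeComparison_app_unit :
    IsIso ((baseChangeComparison F).app (𝟙_ (ModuleCat.{u} R))) := by
  have h : LaxMonoidal.ε (extendScalars (unitRingHom F)) ≫
      (baseChangeComparison F).app (𝟙_ (ModuleCat.{u} R)) = LaxMonoidal.ε F := by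
    ext
    exact baseChangeComparison_app_unit_one F
  have : IsIso (LaxMonoidal.ε (extendScalars (unitRingHom F)) ≫
      (baseChangeComparison F).app (𝟙_ (ModuleCat.{u} R))) := h ▸ inferInstance
  exact IsIso.of_isIso_comp_left (LaxMonoidal.ε (extendScalars (unitRingHom F))) _

lemma baseChangeComparison_app_tensor (M N : ModuleCat.{u} R) (s t : S) (m : M) (n : N) :
    LaxMonoidal.μ F M N
      (((baseChangeComparison F).app M
        (s ⊗ₜ[R,unitRingHom F] m : (extendScalars (unitRingHom F)).obj M)) ⊗ₜ[S]
      ((baseChangeComparison F).app N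
        (t ⊗ₜ[R,unitRingHom F] n : (extendScalars (unitRingHom F)).obj N))) =
    (baseChangeComparison F).app (M ⊗ N)
      ((s * t) ⊗ₜ[R,unitRingHom F] (m ⊗ₜ[R] n) :
        (extendScalars (unitRingHom F)).obj (M ⊗ N)) := by
  rw [baseChangeComparison_app_tmul, baseChangeComparison_app_tmul,
    baseChangeComparison_app_tmul, unitMap_tmul, TensorProduct.smul_tmul_smul]
  exact _root_.map_smul (LaxMonoidal.μ F M N).hom _ _

end Monoidal

end ModuleCat

end

/-- Let `R` and `S` be commutative rings and `F : Mod_R ⥤ Mod_S` a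
colimit-preserving symmetric monoidal functor.  Then there is a ring homomorphism
`φ : R →+* S` such that `F` is naturally monoidally isomorphic to the base-change functor
`S ⊗[R] −` (extension of scalars along `φ`). -/
theorem stmt_9 {R S : Type u} [CommRing R] [CommRing S]
    (F : ModuleCat.{u} R ⥤ ModuleCat.{u} S) [F.Braided]
    [Limits.PreservesColimitsOfSize.{u, u} F] :
    ∃ (φ : R →+* S) (e : F ≅ ModuleCat.extendScalars φ),
      IsMonoidalBaseChangeIso φ F e := by
  have := preservesColimitsOfSize_shrink.{0, u, 0, u} F
  have : F.PreservesZeroMorphisms := preservesZeroMorphisms_of_map_zero_object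
    ((HasZeroObject.zeroIsInitial.isInitialObj F _).uniqueUpToIso HasZeroObject.zeroIsInitial)
  have := preservesBinaryBiproducts_of_preservesBinaryCoproducts F
  have : F.Additive := additive_of_preservesBinaryBiproducts F
  have : PreservesColimitsOfSize.{u, u} (ModuleCat.extendScalars (ModuleCat.unitRingHom F)) :=
    (ModuleCat.extendRestrictScalarsAdj _).leftAdjoint_preservesColimits
  have := ModuleCat.isIso_of_isIso_app_unit (ModuleCat.baseChangeComparison F)
  let e := (asIso (ModuleCat.baseChangeComparison F)).symm
  have he (M : ModuleCat.{u} R)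
      (x : (ModuleCat.extendScalars (ModuleCat.unitRingHom F)).obj M) :
      e.hom.app M ((ModuleCat.baseChangeComparison F).app M x) = x :=
    congr($(e.inv_hom_id_app M) x)
  refine ⟨ModuleCat.unitRingHom F, e, ?_, fun M N s t m n ↦ ?_⟩
  · rw [← ModuleCat.baseChangeComparison_app_unit_one]
    exact he _ _
  · exact (congrArg (e.hom.app (M ⊗ N))
      (ModuleCat.baseChangeComparison_app_tensor F M N s t m n)).trans (he _ _)
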